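/- Let f = x³ + y⁷ + t·x·y⁵ ∈ ℚ(t)[x,y]. Then the localization of ℚ(t)[x,y]/(∂f/∂x, ∂f/∂y) at the maximal ideal (x,y) is a ℚ(t)-vector space of dimension 12; in particular the Milnor number at the origin of the μ-constant family is 12, independent of t. -/

import Mathlib

open MvPolynomial

/-- The field ℚ(t). -/
abbrev K : Type := RatFunc ℚ

noncomputable def t : MvPolynomial (Fin 2) K := C RatFunc.X
noncomputable def x : MvPolynomial (Fin 2) K := X 0
noncomputable def y : MvPolynomial (Fin 2) K := X 1
noncomputable def f : MvPolynomial (Fin 2) K := x ^ 3 + y ^ 7 + t * x * y ^ 5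

/-- The multiplicative set of polynomials not vanishing at the origin,
the complement of the maximal ideal `(x, y)`. -/
noncomputable def S : Submonoid (MvPolynomial (Fin 2) K) where
  carrier := {q | eval (fun _ => (0 : K)) q ≠ 0}
  one_mem' := by simp
  mul_mem' := by
    intro a b ha hb
    simp only [Set.mem_setOf_eq, map_mul] at *
    exact mul_ne_zero ha hb

/-- The Jacobian ideal in the local ring at the origin. -/
noncomputable def Jloc : Ideal (Localization S) :=
  Ideal.span {algebraMap (MvPolynomial (Fin 2) K) (Localization S) (pderiv 0 f),
    algebraMap (MvPolynomial (Fin 2) K) (Localization S) (pderiv 1 f)}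

noncomputable instance : Algebra K (Localization S) :=
  ((algebraMap (MvPolynomial (Fin 2) K) (Localization S)).comp
    (algebraMap K (MvPolynomial (Fin 2) K))).toAlgebra

section NormalForm

variable {F : Type*}

/-- The exponent vector of `x ^ i * y ^ j`. -/
noncomputable def expo (i j : ℕ) : Fin 2 →₀ ℕ := Finsupp.single 0 i + Finsupp.single 1 j

@[simp] lemma expo_zero (i j : ℕ) : expo i j 0 = i := by simp [expo]

@[simp] lemma expo_one (i j : ℕ) : expo i j 1 = j := by simp [expo]

lemma eq_expo (m : Fin 2 →₀ ℕ) : m = expo (m 0) (m 1) := by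
  ext i; fin_cases i <;> simp

lemma degree_expo (i j : ℕ) : (expo i j).degree = i + j := by simp [expo]

lemma expo_le_iff {i j k l : ℕ} : expo i j ≤ expo k l ↔ i ≤ k ∧ j ≤ l := by
  simp [Finsupp.le_def, Fin.forall_fin_two]

lemma expo_inj {i j k l : ℕ} : expo i j = expo k l ↔ i = k ∧ j = l := by
  simp [Finsupp.ext_iff, Fin.forall_fin_two]

lemma expo_sub (i j k l : ℕ) : expo k l - expo i j = expo (k - i) (l - j) := by
  ext n; fin_cases n <;> simp

lemma monomial_expo [CommSemiring F] (i j : ℕ) (c : F) :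
    monomial (expo i j) c = C c * X 0 ^ i * X 1 ^ j := by
  rw [X_pow_eq_monomial, X_pow_eq_monomial, C_mul_monomial, monomial_mul, expo, mul_one, mul_one]

variable [Field F]

/-- Coefficient of `x ^ i * y ^ j`. -/
noncomputable def coef (i j : ℕ) : MvPolynomial (Fin 2) F →ₗ[F] F := lcoeff F (expo i j)

lemma coef_monomial (i j k l : ℕ) (c : F) :
    coef k l (monomial (expo i j) c) = if i = k ∧ j = l then c else 0 := by
  simp only [coef, lcoeff_apply, coeff_monomial, expo_inj]

lemma coef_mul_monomial (i j k l : ℕ) (c : F) (p : MvPolynomial (Fin 2) F) :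
    coef k l (p * monomial (expo i j) c) =
      if i ≤ k ∧ j ≤ l then coef (k - i) (l - j) p * c else 0 := by
  simp only [coef, lcoeff_apply, coeff_mul_monomial', expo_le_iff, expo_sub]

/-- Coordinates, with respect to the monomials `x ^ i * y ^ j` with `i ≤ 1` and `j ≤ 5`, of the
normal form of a polynomial modulo `x ^ 2 = a * y ^ 5` and `y ^ 6 = b * x * y ^ 4`. -/
noncomputable def normalForm (a b : F) : MvPolynomial (Fin 2) F →ₗ[F] (Fin 12 → F) :=
  LinearMap.pi ![coef 0 0, coef 0 1, coef 0 2, coef 0 3, coef 0 4, coef 0 5 + a • coef 2 0,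
    coef 1 0, coef 1 1, coef 1 2, coef 1 3,
    coef 1 4 + (a * b) • coef 2 1 + b • coef 0 6,
    coef 1 5 + (a * b) • coef 2 2 + b • coef 0 7 + a • coef 3 0]

/-- The polynomial with prescribed coordinates. -/
noncomputable def ofCoords : (Fin 12 → F) →ₗ[F] MvPolynomial (Fin 2) F :=
  Fintype.linearCombination F ![monomial (expo 0 0) 1, monomial (expo 0 1) 1,
    monomial (expo 0 2) 1, monomial (expo 0 3) 1, monomial (expo 0 4) 1, monomial (expo 0 5) 1,
    monomial (expo 1 0) 1, monomial (expo 1 1) 1, monomial (expo 1 2) 1, monomial (expo 1 3) 1,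
    monomial (expo 1 4) 1, monomial (expo 1 5) 1]

lemma normalForm_ofCoords (a b : F) (v : Fin 12 → F) : normalForm a b (ofCoords v) = v := by
  ext i
  fin_cases i <;>
  simp [normalForm, ofCoords, Fintype.linearCombination_apply, Fin.sum_univ_succ, coef_monomial]

lemma normalForm_mul_left (a b : F) (p : MvPolynomial (Fin 2) F) :
    normalForm a b (p * (X 0 ^ 2 - C a * X 1 ^ 5)) = 0 := by
  have h : (X 0 ^ 2 - C a * X 1 ^ 5 : MvPolynomial (Fin 2) F) =
      monomial (expo 2 0) 1 - monomial (expo 0 5) a := by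
    simp [monomial_expo]
  rw [h, mul_sub]
  ext i
  fin_cases i <;> simp [normalForm, coef_mul_monomial] <;> ring

lemma normalForm_mul_right (a b : F) (p : MvPolynomial (Fin 2) F) :
    normalForm a b (p * (X 1 ^ 6 - C b * X 0 * X 1 ^ 4)) = 0 := by
  have h : (X 1 ^ 6 - C b * X 0 * X 1 ^ 4 : MvPolynomial (Fin 2) F) =
      monomial (expo 0 6) 1 - monomial (expo 1 4) b := by
    simp [monomial_expo]
  rw [h, mul_sub]
  ext i
  fin_cases i <;> simp [normalForm, coef_mul_monomial] <;> ring

lemma normalForm_eq_zero_of_mem (a b : F) {p : MvPolynomial (Fin 2) F}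
    (hp : p ∈ Ideal.span {X 0 ^ 2 - C a * X 1 ^ 5, X 1 ^ 6 - C b * X 0 * X 1 ^ 4}) :
    normalForm a b p = 0 := by
  obtain ⟨u, v, rfl⟩ := Ideal.mem_span_pair.mp hp
  rw [map_add, normalForm_mul_left, normalForm_mul_right, add_zero]

lemma normalForm_eq_zero_of_mem_pow (a b : F) {p : MvPolynomial (Fin 2) F}
    (hp : p ∈ idealOfVars (Fin 2) F ^ 8) : normalForm a b p = 0 := by
  have h (i j : ℕ) (hij : i + j < 8) : coef i j p = 0 :=
    (mem_pow_idealOfVars_iff' 8 p).mp hp _ (by rwa [degree_expo])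
  ext i
  fin_cases i <;> simp [normalForm, h]

/-- A polynomial with constant coefficient `c` divides a power of `c` modulo high order terms. -/
lemma exists_mul_sub_C_mem_pow (s : MvPolynomial (Fin 2) F) (n : ℕ) :
    ∃ u, u * s - C (eval (fun _ => 0) s ^ n) ∈ idealOfVars (Fin 2) F ^ n := by
  set c := eval (fun _ => (0 : F)) s
  have hs : C c - s ∈ idealOfVars (Fin 2) F := by
    rw [← pow_one (idealOfVars _ _), mem_pow_idealOfVars_iff']
    intro m hm
    obtain rfl : m = 0 := by simpa [Finsupp.degree_eq_zero_iff] using hm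
    simp [c, ← constantCoeff_eq, eval_zero']
  obtain ⟨u, hu⟩ := sub_dvd_pow_sub_pow (C c) (C c - s) n
  refine ⟨u, ?_⟩
  have : u * s - C (c ^ n) = -(C c - s) ^ n := by
    rw [map_pow]
    linear_combination -hu
  rw [this]
  exact neg_mem (Ideal.pow_mem_pow hs n)

lemma map_ofCoords {Q : Type*} [CommRing Q] (φ : MvPolynomial (Fin 2) F →+* Q)
    (v : Fin 12 → F) : φ (ofCoords v) =
      φ (C (v 0)) + φ (C (v 1)) * φ (X 1) + φ (C (v 2)) * φ (X 1) ^ 2 +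
      φ (C (v 3)) * φ (X 1) ^ 3 + φ (C (v 4)) * φ (X 1) ^ 4 + φ (C (v 5)) * φ (X 1) ^ 5 +
      φ (C (v 6)) * φ (X 0) + φ (C (v 7)) * φ (X 0) * φ (X 1) +
      φ (C (v 8)) * φ (X 0) * φ (X 1) ^ 2 + φ (C (v 9)) * φ (X 0) * φ (X 1) ^ 3 +
      φ (C (v 10)) * φ (X 0) * φ (X 1) ^ 4 + φ (C (v 11)) * φ (X 0) * φ (X 1) ^ 5 := by
  simp [ofCoords, Fintype.linearCombination_apply, Fin.sum_univ_succ, monomial_expo, smul_eq_C_mul]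
  ring

/-- Modulo the two relations, and once `1 - a * b ^ 2 * y` is invertible, every polynomial is
congruent to its normal form. -/
lemma map_ofCoords_normalForm {Q : Type*} [CommRing Q] (φ : MvPolynomial (Fin 2) F →+* Q)
    (a b : F) (ha : φ (X 0) ^ 2 = φ (C a) * φ (X 1) ^ 5)
    (hb : φ (X 1) ^ 6 = φ (C b) * φ (X 0) * φ (X 1) ^ 4)
    (hu : IsUnit (φ (1 - C (a * b ^ 2) * X 1))) (p : MvPolynomial (Fin 2) F) :
    φ (ofCoords (normalForm a b p)) = φ p := by
  induction p using MvPolynomial.induction_on' with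
  | add p q hp hq => simp only [map_add, hp, hq]
  | monomial m c =>
    obtain ⟨i, j, rfl⟩ : ∃ i j, m = expo i j := ⟨_, _, eq_expo m⟩
    have h16 : φ (X 0) * φ (X 1) ^ 6 = 0 := by
      refine (hu.mul_left_eq_zero).mp ?_
      simp only [map_sub, map_mul, map_pow, map_one]
      linear_combination (φ (X 0) + φ (C a) * φ (C b) * φ (X 1) ^ 3) * hb +
        φ (C b) * φ (X 1) ^ 4 * ha
    have h08 : φ (X 1) ^ 8 = 0 := by
      linear_combination φ (X 1) ^ 2 * hb + φ (C b) * h16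
    have h23 : φ (X 0) ^ 2 * φ (X 1) ^ 3 = 0 := by
      linear_combination φ (X 1) ^ 3 * ha + φ (C a) * h08
    have h31 : φ (X 0) ^ 3 * φ (X 1) = 0 := by
      linear_combination φ (X 0) * φ (X 1) * ha + φ (C a) * h16
    have h40 : φ (X 0) ^ 4 = 0 := by
      linear_combination (φ (X 0) ^ 2 + φ (C a) * φ (X 1) ^ 5) * ha +
        φ (C a) ^ 2 * φ (X 1) ^ 2 * h08
    have hφ : φ (monomial (expo i j) c) = φ (C c) * φ (X 0) ^ i * φ (X 1) ^ j := by
      simp only [monomial_expo, map_mul, map_pow]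
    rw [map_ofCoords, hφ]
    clear hφ
    match i, j with
    | 0, 0 | 0, 1 | 0, 2 | 0, 3 | 0, 4 | 0, 5
    | 1, 0 | 1, 1 | 1, 2 | 1, 3 | 1, 4 | 1, 5 => simp [normalForm, coef_monomial]
    | 0, 6 =>
      simp [normalForm, coef_monomial]
      linear_combination -φ (C c) * hb
    | 0, 7 =>
      simp [normalForm, coef_monomial]
      linear_combination -φ (C c) * φ (X 1) * hb
    | 2, 0 =>
      simp [normalForm, coef_monomial]
      linear_combination -φ (C c) * ha
    | 2, 1 =>
      simp [normalForm, coef_monomial]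
      linear_combination -φ (C c) * (φ (X 1) * ha + φ (C a) * hb)
    | 2, 2 =>
      simp [normalForm, coef_monomial]
      linear_combination -φ (C c) * φ (X 1) * (φ (X 1) * ha + φ (C a) * hb)
    | 3, 0 =>
      simp [normalForm, coef_monomial]
      linear_combination -φ (C c) * φ (X 0) * ha
    | 0, n + 8 =>
      simp [normalForm, coef_monomial]
      linear_combination -φ (C c) * φ (X 1) ^ n * h08
    | 1, n + 6 =>
      simp [normalForm, coef_monomial]
      linear_combination -φ (C c) * φ (X 1) ^ n * h16
    | 2, n + 3 =>
      simp [normalForm, coef_monomial]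
      linear_combination -φ (C c) * φ (X 1) ^ n * h23
    | 3, n + 1 =>
      simp [normalForm, coef_monomial]
      linear_combination -φ (C c) * φ (X 1) ^ n * h31
    | m + 4, n =>
      simp [normalForm, coef_monomial]
      linear_combination -φ (C c) * φ (X 0) ^ m * φ (X 1) ^ n * h40

end NormalForm

section Jacobian

/-- The value of `a` in the relation `x ^ 2 = a * y ^ 5`. -/
noncomputable def relA : K := -(RatFunc.X / 3)

/-- The value of `b` in the relation `y ^ 6 = b * x * y ^ 4`. -/
noncomputable def relB : K := -(5 * RatFunc.X / 7)

lemma pderiv_zero_f : pderiv 0 f = C 3 * (X 0 ^ 2 - C relA * X 1 ^ 5) := by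
  have h : (C 3 * C relA : MvPolynomial (Fin 2) K) = -C RatFunc.X := by
    rw [← C_mul, ← C_neg, relA]
    congr 1
    field_simp
  have h3 : (C 3 : MvPolynomial (Fin 2) K) = 3 := map_ofNat C 3
  rw [mul_sub, ← mul_assoc, h, h3]
  simp [f, t, x, y, pderiv_X]
  ring

lemma pderiv_one_f : pderiv 1 f = C 7 * (X 1 ^ 6 - C relB * X 0 * X 1 ^ 4) := by
  have h : (C 7 * C relB : MvPolynomial (Fin 2) K) = -(5 * C RatFunc.X) := by
    rw [← map_ofNat C 5, ← C_mul, ← C_mul, ← C_neg, relB]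
    congr 1
    field_simp
  have h7 : (C 7 : MvPolynomial (Fin 2) K) = 7 := map_ofNat C 7
  rw [mul_sub, ← mul_assoc, ← mul_assoc, h, h7]
  simp [f, t, x, y, pderiv_X]
  ring

lemma Jloc_eq_map : Jloc = Ideal.map (algebraMap (MvPolynomial (Fin 2) K) (Localization S))
    (Ideal.span {X 0 ^ 2 - C relA * X 1 ^ 5, X 1 ^ 6 - C relB * X 0 * X 1 ^ 4}) := by
  have h3 : IsUnit (C 3 : MvPolynomial (Fin 2) K) := (IsUnit.mk0 3 (by norm_num)).map C
  have h7 : IsUnit (C 7 : MvPolynomial (Fin 2) K) := (IsUnit.mk0 7 (by norm_num)).map C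
  rw [Jloc, ← Set.image_pair, ← Ideal.map_span, Ideal.span_insert, Ideal.span_insert,
    pderiv_zero_f, pderiv_one_f, Ideal.span_singleton_mul_left_unit h3,
    Ideal.span_singleton_mul_left_unit h7]

/-- The map from polynomials to the local Milnor algebra. -/
noncomputable def toMilnor : MvPolynomial (Fin 2) K →+* Localization S ⧸ Jloc :=
  (Ideal.Quotient.mk Jloc).comp (algebraMap _ _)

lemma toMilnor_eq_zero_of_mem {p : MvPolynomial (Fin 2) K}
    (hp : p ∈ Ideal.span {X 0 ^ 2 - C relA * X 1 ^ 5, X 1 ^ 6 - C relB * X 0 * X 1 ^ 4}) :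
    toMilnor p = 0 := by
  rw [toMilnor, RingHom.comp_apply, Ideal.Quotient.eq_zero_iff_mem, Jloc_eq_map]
  exact Ideal.mem_map_of_mem _ hp

lemma isUnit_toMilnor {s : MvPolynomial (Fin 2) K} (hs : s ∈ S) : IsUnit (toMilnor s) :=
  (IsLocalization.map_units (Localization S) ⟨s, hs⟩).map (Ideal.Quotient.mk Jloc)

lemma toMilnor_ofCoords_normalForm (p : MvPolynomial (Fin 2) K) :
    toMilnor (ofCoords (normalForm relA relB p)) = toMilnor p := by
  have hu : IsUnit (toMilnor (1 - C (relA * relB ^ 2) * X 1)) := by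
    apply isUnit_toMilnor
    change eval _ _ ≠ 0
    simp
  refine map_ofCoords_normalForm (F := K) (Q := Localization S ⧸ Jloc) toMilnor relA relB
    ?_ ?_ hu p
  · have := toMilnor_eq_zero_of_mem (Ideal.subset_span (Set.mem_insert _ _))
    simpa only [map_sub, map_mul, map_pow, sub_eq_zero] using this
  · have := toMilnor_eq_zero_of_mem (Ideal.subset_span (Set.mem_insert_of_mem _ rfl))
    simpa only [map_sub, map_mul, map_pow, sub_eq_zero] using this

lemma toMilnor_eq_zero_iff (p : MvPolynomial (Fin 2) K) :
    toMilnor p = 0 ↔ normalForm relA relB p = 0 := by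
  refine ⟨fun h => ?_, fun h => by rw [← toMilnor_ofCoords_normalForm, h, map_zero, map_zero]⟩
  rw [toMilnor, RingHom.comp_apply, Ideal.Quotient.eq_zero_iff_mem, Jloc_eq_map,
    IsLocalization.algebraMap_mem_map_algebraMap_iff S] at h
  obtain ⟨s, hs, hsp⟩ := h
  obtain ⟨u, hu⟩ := exists_mul_sub_C_mem_pow s 8
  have h1 := normalForm_eq_zero_of_mem relA relB (Ideal.mul_mem_left _ u hsp)
  have h2 := normalForm_eq_zero_of_mem_pow relA relB (Ideal.mul_mem_right p _ hu)
  rw [sub_mul, map_sub, mul_assoc, h1, zero_sub, neg_eq_zero, ← smul_eq_C_mul, map_smul] at h2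
  exact (smul_eq_zero.mp h2).resolve_left (pow_ne_zero 8 hs)

lemma toMilnor_surjective : Function.Surjective toMilnor := by
  intro z
  obtain ⟨w, rfl⟩ := Ideal.Quotient.mk_surjective z
  obtain ⟨⟨r, s, hs⟩, hrs⟩ := IsLocalization.surj S w
  obtain ⟨u, hu⟩ := exists_mul_sub_C_mem_pow s 8
  set c := eval (fun _ => (0 : K)) s
  have h1 := (toMilnor_eq_zero_iff _).mpr (normalForm_eq_zero_of_mem_pow relA relB hu)
  have h2 : Ideal.Quotient.mk Jloc w * toMilnor s = toMilnor r := by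
    simpa only [map_mul] using! congrArg (Ideal.Quotient.mk Jloc) hrs
  have h3 : toMilnor (C (c ^ 8)) * toMilnor (C (c ^ 8)⁻¹) = 1 := by
    rw [← map_mul, ← C_mul, mul_inv_cancel₀ (pow_ne_zero 8 hs), C_1, map_one]
  refine ⟨C (c ^ 8)⁻¹ * u * r, ?_⟩
  rw [map_sub, map_mul] at h1
  rw [map_mul, map_mul]
  linear_combination -toMilnor (C (c ^ 8)⁻¹) * toMilnor u * h2 +
    Ideal.Quotient.mk Jloc w * h3 + toMilnor (C (c ^ 8)⁻¹) * Ideal.Quotient.mk Jloc w * h1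

/-- `toMilnor` as a `K`-linear map. -/
noncomputable def toMilnorLinear : MvPolynomial (Fin 2) K →ₗ[K] Localization S ⧸ Jloc where
  toFun := toMilnor
  map_add' := map_add toMilnor
  map_smul' c p := by
    have h : algebraMap (MvPolynomial (Fin 2) K) (Localization S) (c • p) =
        c • algebraMap (MvPolynomial (Fin 2) K) (Localization S) p := by
      rw [Algebra.algebraMap_eq_smul_one, Algebra.algebraMap_eq_smul_one, smul_assoc]
    exact congrArg (Ideal.Quotient.mk Jloc) h

end Jacobian

theorem stmt12 : Module.finrank K (Localization S ⧸ Jloc) = 12 := by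
  have hker : LinearMap.ker toMilnorLinear = LinearMap.ker (normalForm relA relB) :=
    Submodule.ext toMilnor_eq_zero_iff
  have hsurj : Function.Surjective (normalForm relA relB) := fun v =>
    ⟨ofCoords v, normalForm_ofCoords _ _ v⟩
  rw [← (toMilnorLinear.quotKerEquivOfSurjective toMilnor_surjective).finrank_eq, hker,
    ((normalForm relA relB).quotKerEquivOfSurjective hsurj).finrank_eq, Module.finrank_fin_fun]
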